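/- arXiv:2312.06551 — 5 statements merged into one kernel-verified Lean document; each statement's English description precedes it below -/
import Mathlib

section
/- Fix a Hermitian positive semidefinite matrix Σcov ∈ ℂ^{N×N} and σ > 0. For a positive integer m, a Hermitian positive semidefinite kernel Σ ∈ ℂ^{N×N}, and a measurement matrix S ∈ ℂ^{m×N} with S Sᴴ = I_m, define the mean squared error E(Σ, S) = Re Tr(Πᴴ (S Σcov Sᴴ + σ² I_m) Π) − 2 Re Tr(Πᴴ S Σcov) + Re Tr(Σcov), where Π = (S Σ Sᴴ + σ² I_m)⁻¹ S Σ. Then for every m ≤ N, every such Σ and S, one has E(Σ, S) ≥ Re Tr(Σcov) − Re Tr(Σcov (Σcov + σ² I_N)⁻¹ Σcov), and equality is attained by taking Σ = Σcov and S = I_N (with m = N). In particular the minimum achievable MSE is E_min = Re Tr(Σcov) − Re Tr(Σcov (Σcov + σ² I_N)⁻¹ Σcov). -/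
open Matrix
open scoped ComplexOrder

/-- The kernel-based Bayesian regression matrix `Π = (S Σ Sᴴ + σ² I_m)⁻¹ S Σ`. -/
noncomputable def regMat {N m : ℕ} (K : Matrix (Fin N) (Fin N) ℂ) (σ : ℝ)
    (S : Matrix (Fin m) (Fin N) ℂ) : Matrix (Fin m) (Fin N) ℂ :=
  (S * K * Sᴴ + ((σ : ℂ) ^ 2) • (1 : Matrix (Fin m) (Fin m) ℂ))⁻¹ * S * K

/-- The MSE functional of Lemma 1:
`E = Re Tr(Πᴴ (S Σcov Sᴴ + σ² I_m) Π) − 2 Re Tr(Πᴴ S Σcov) + Re Tr(Σcov)`. -/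
noncomputable def sbarMSE {N m : ℕ} (Ccov : Matrix (Fin N) (Fin N) ℂ) (σ : ℝ)
    (S : Matrix (Fin m) (Fin N) ℂ) (Pm : Matrix (Fin m) (Fin N) ℂ) : ℝ :=
  (Pmᴴ * (S * Ccov * Sᴴ + ((σ : ℂ) ^ 2) • (1 : Matrix (Fin m) (Fin m) ℂ)) * Pm).trace.re
    - 2 * (Pmᴴ * (S * Ccov)).trace.re + Ccov.trace.re

/-- Adding a positive multiple of the identity to a positive semidefinite matrix gives a positive
definite matrix. -/
lemma posDef_add_sq_smul_one {n : Type*} [Fintype n] [DecidableEq n] {A : Matrix n n ℂ}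
    (hA : A.PosSemidef) {σ : ℝ} (hσ : 0 < σ) :
    (A + ((σ : ℂ) ^ 2) • (1 : Matrix n n ℂ)).PosDef := by
  have h : (0 : ℂ) < (σ : ℂ) ^ 2 := by exact_mod_cast pow_pos hσ 2
  exact Matrix.PosDef.posSemidef_add hA (Matrix.PosDef.one.smul h)

/-- Completing the square in a Hermitian matrix quadratic form, at the level of traces. -/
lemma trace_re_complete_square {n k : Type*} [Fintype n] [DecidableEq n] [Fintype k]
    {M : Matrix n n ℂ} (hM : M.IsHermitian) (hMu : IsUnit M.det) (C W : Matrix n k ℂ) :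
    (Wᴴ * M * W).trace.re - 2 * (Wᴴ * C).trace.re =
      ((W - M⁻¹ * C)ᴴ * M * (W - M⁻¹ * C)).trace.re - (Cᴴ * M⁻¹ * C).trace.re := by
  have hinv : (M⁻¹)ᴴ = M⁻¹ := hM.inv
  have hexp : (W - M⁻¹ * C)ᴴ * M * (W - M⁻¹ * C) =
      Wᴴ * M * W - Wᴴ * C - Cᴴ * W + Cᴴ * M⁻¹ * C := by
    rw [conjTranspose_sub, conjTranspose_mul, hinv, Matrix.sub_mul, Matrix.mul_assoc Cᴴ,
      nonsing_inv_mul _ hMu, Matrix.mul_one, Matrix.sub_mul, Matrix.mul_sub, Matrix.mul_sub,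
      Matrix.mul_assoc Wᴴ M (M⁻¹ * C), mul_nonsing_inv_cancel_left _ _ hMu, ← Matrix.mul_assoc]
    abel
  have hconj : (Cᴴ * W).trace.re = (Wᴴ * C).trace.re := by
    rw [← conjTranspose_conjTranspose W, ← conjTranspose_mul, trace_conjTranspose,
      conjTranspose_conjTranspose, Complex.star_def, Complex.conj_re]
  rw [hexp]
  simp only [trace_add, trace_sub, Complex.add_re, Complex.sub_re, hconj]
  ring

/-- For measurements with orthonormal rows, the MSE is the minimum MSE plus a nonnegative quadratic
form in the deviation of the reconstructor from the full-observation one. -/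
lemma sbarMSE_eq {N m : ℕ} {C : Matrix (Fin N) (Fin N) ℂ} (hC : C.PosSemidef) {σ : ℝ}
    (hσ : 0 < σ) {S : Matrix (Fin m) (Fin N) ℂ} (hS : S * Sᴴ = 1)
    (P : Matrix (Fin m) (Fin N) ℂ) :
    sbarMSE C σ S P =
      ((Sᴴ * P - (C + ((σ : ℂ) ^ 2) • (1 : Matrix (Fin N) (Fin N) ℂ))⁻¹ * C)ᴴ *
        (C + ((σ : ℂ) ^ 2) • (1 : Matrix (Fin N) (Fin N) ℂ)) *
        (Sᴴ * P - (C + ((σ : ℂ) ^ 2) • (1 : Matrix (Fin N) (Fin N) ℂ))⁻¹ * C)).trace.re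
      + (C.trace.re
        - (C * (C + ((σ : ℂ) ^ 2) • (1 : Matrix (Fin N) (Fin N) ℂ))⁻¹ * C).trace.re) := by
  have hM := posDef_add_sq_smul_one hC hσ
  have hsq := trace_re_complete_square hM.isHermitian
    ((Matrix.isUnit_iff_isUnit_det _).1 hM.isUnit) C (Sᴴ * P)
  rw [hC.isHermitian.eq] at hsq
  have hquad : Pᴴ * (S * C * Sᴴ + ((σ : ℂ) ^ 2) • (1 : Matrix (Fin m) (Fin m) ℂ)) * P =
      (Sᴴ * P)ᴴ * (C + ((σ : ℂ) ^ 2) • (1 : Matrix (Fin N) (Fin N) ℂ)) * (Sᴴ * P) := by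
    rw [← hS]
    simp only [conjTranspose_mul, conjTranspose_conjTranspose, Matrix.mul_add, Matrix.add_mul,
      Matrix.mul_smul, Matrix.smul_mul, Matrix.mul_one, Matrix.mul_assoc]
  have hlin : Pᴴ * (S * C) = (Sᴴ * P)ᴴ * C := by
    rw [conjTranspose_mul, conjTranspose_conjTranspose, Matrix.mul_assoc]
  rw [sbarMSE, hquad, hlin]
  linarith

/-- **Lemma 2 (Achievable minimum MSE of S-BAR).**
For every `m ≤ N`, every PSD kernel `K`, and every measurement matrix `S` with
`S Sᴴ = I_m`, the MSE `E(K, S)` of the kernel-based reconstructor is at least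
`E_min = Re Tr(Σcov) − Re Tr(Σcov (Σcov + σ² I_N)⁻¹ Σcov)`, and equality is
attained by taking `K = Σcov` and `S = I_N` (full observation, `m = N`). -/
theorem sbar_min_mse
    {N : ℕ} (hN : 0 < N)
    (Ccov : Matrix (Fin N) (Fin N) ℂ) (hCcov : Ccov.PosSemidef)
    (σ : ℝ) (hσ : 0 < σ) :
    (∀ (m : ℕ), 0 < m → m ≤ N →
      ∀ (K : Matrix (Fin N) (Fin N) ℂ), K.PosSemidef →
      ∀ (S : Matrix (Fin m) (Fin N) ℂ), S * Sᴴ = 1 →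
        Ccov.trace.re
            - (Ccov * (Ccov + ((σ : ℂ) ^ 2) • (1 : Matrix (Fin N) (Fin N) ℂ))⁻¹ * Ccov).trace.re ≤
          sbarMSE Ccov σ S (regMat K σ S)) ∧
    sbarMSE Ccov σ (1 : Matrix (Fin N) (Fin N) ℂ)
        (regMat Ccov σ (1 : Matrix (Fin N) (Fin N) ℂ)) =
      Ccov.trace.re
        - (Ccov * (Ccov + ((σ : ℂ) ^ 2) • (1 : Matrix (Fin N) (Fin N) ℂ))⁻¹ * Ccov).trace.re := by
  refine ⟨fun m _ _ K _ S hS => ?_, ?_⟩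
  · rw [sbarMSE_eq hCcov hσ hS]
    have h := ((posDef_add_sq_smul_one hCcov hσ).posSemidef.conjTranspose_mul_mul_same
      (Sᴴ * regMat K σ S -
        (Ccov + ((σ : ℂ) ^ 2) • (1 : Matrix (Fin N) (Fin N) ℂ))⁻¹ * Ccov)).trace_nonneg
    exact le_add_of_nonneg_left (Complex.nonneg_iff.1 h).1
  · rw [sbarMSE_eq hCcov hσ (by simp)]
    simp [regMat]
end

section
/- Fix a Hermitian positive semidefinite matrix Σcov ∈ ℂ^{N×N} and σ > 0. Let m ≤ N be a positive integer, let Σ ∈ ℂ^{N×N} be Hermitian positive semidefinite, and let S ∈ ℂ^{m×N} satisfy S Sᴴ = I_m. With Π = (S Σ Sᴴ + σ² I_m)⁻¹ S Σ, the quantity E(Σ, S) = Re Tr(Πᴴ (S Σcov Sᴴ + σ² I_m) Π) − 2 Re Tr(Πᴴ S Σcov) + Re Tr(Σcov) satisfies the lower bound E(Σ, S) ≥ Re Tr(Σcov) − Re Tr(Σcov (Σcov + σ² I_N)⁻¹ Σcov). -/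
open Matrix
open scoped ComplexOrder

/-- Completing the square: the quadratic form of a positive definite matrix minus its linear
part is minimised at `A⁻¹ * C`. -/
theorem Matrix.PosDef.two_mul_re_trace_sub_le {n k : Type*} [Fintype n] [DecidableEq n]
    [Fintype k] {A : Matrix n n ℂ} (hA : A.PosDef) (C X : Matrix n k ℂ) :
    2 * (Xᴴ * C).trace.re - (Cᴴ * A⁻¹ * C).trace.re ≤ (Xᴴ * A * X).trace.re := by
  have hdet : IsUnit A.det := (isUnit_iff_isUnit_det A).mp hA.isUnit
  have hsq : (X - A⁻¹ * C)ᴴ * A * (X - A⁻¹ * C)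
      = Xᴴ * A * X - Xᴴ * C - (Xᴴ * C)ᴴ + Cᴴ * A⁻¹ * C := by
    have h₁ : Xᴴ * A * (A⁻¹ * C) = Xᴴ * C := by
      rw [Matrix.mul_assoc, mul_nonsing_inv_cancel_left _ _ hdet]
    have h₂ : (A⁻¹ * C)ᴴ * A = Cᴴ := by
      rw [conjTranspose_mul, conjTranspose_nonsing_inv, hA.isHermitian.eq,
        nonsing_inv_mul_cancel_right _ _ hdet]
    rw [conjTranspose_sub, Matrix.sub_mul, h₂, Matrix.sub_mul, Matrix.mul_sub, Matrix.mul_sub, h₁,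
      conjTranspose_mul, conjTranspose_conjTranspose, Matrix.mul_assoc Cᴴ]
    abel
  have hnonneg : 0 ≤ ((X - A⁻¹ * C)ᴴ * A * (X - A⁻¹ * C)).trace.re :=
    (Complex.le_def.mp (hA.posSemidef.conjTranspose_mul_mul_same (X - A⁻¹ * C)).trace_nonneg).1
  rw [hsq, trace_add, trace_sub, trace_sub, trace_conjTranspose] at hnonneg
  simp only [Complex.add_re, Complex.sub_re, Complex.star_def, Complex.conj_re] at hnonneg
  linarith

/-- **Lower bound on the S-BAR MSE.** For `m ≤ N`, a PSD kernel `K`, and `S`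
with orthonormal rows (`S Sᴴ = I_m`), the MSE of the kernel-based Bayesian
reconstructor `Π = (S K Sᴴ + σ² I_m)⁻¹ S K` satisfies
`E(K, S) ≥ Re Tr(Σcov) − Re Tr(Σcov (Σcov + σ² I_N)⁻¹ Σcov)`. -/
theorem sbar_mse_lower_bound
    {N m : ℕ} (hN : 0 < N) (hm : 0 < m) (hmN : m ≤ N)
    (Ccov : Matrix (Fin N) (Fin N) ℂ) (hCcov : Ccov.PosSemidef)
    (σ : ℝ) (hσ : 0 < σ)
    (K : Matrix (Fin N) (Fin N) ℂ) (hK : K.PosSemidef)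
    (S : Matrix (Fin m) (Fin N) ℂ) (hS : S * Sᴴ = 1)
    (Pm : Matrix (Fin m) (Fin N) ℂ)
    (hPm : Pm = (S * K * Sᴴ + ((σ : ℂ) ^ 2) • (1 : Matrix (Fin m) (Fin m) ℂ))⁻¹ * S * K) :
    Ccov.trace.re
        - (Ccov * (Ccov + ((σ : ℂ) ^ 2) • (1 : Matrix (Fin N) (Fin N) ℂ))⁻¹ * Ccov).trace.re ≤
      (Pmᴴ * (S * Ccov * Sᴴ + ((σ : ℂ) ^ 2) • (1 : Matrix (Fin m) (Fin m) ℂ)) * Pm).trace.re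
        - 2 * (Pmᴴ * (S * Ccov)).trace.re + Ccov.trace.re := by
  have hσ' : (0 : ℂ) < (σ : ℂ) ^ 2 := by exact_mod_cast pow_pos hσ 2
  have hA : (Ccov + ((σ : ℂ) ^ 2) • (1 : Matrix (Fin N) (Fin N) ℂ)).PosDef :=
    PosDef.posSemidef_add hCcov (PosDef.one.smul hσ')
  have hmin := hA.two_mul_re_trace_sub_le Ccov (Sᴴ * Pm)
  have hquad : (Sᴴ * Pm)ᴴ * (Ccov + ((σ : ℂ) ^ 2) • (1 : Matrix (Fin N) (Fin N) ℂ)) * (Sᴴ * Pm)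
      = Pmᴴ * (S * Ccov * Sᴴ + ((σ : ℂ) ^ 2) • (1 : Matrix (Fin m) (Fin m) ℂ)) * Pm := by
    rw [← hS]
    simp only [conjTranspose_mul, conjTranspose_conjTranspose, Matrix.mul_add, Matrix.add_mul,
      Matrix.mul_smul, Matrix.smul_mul, Matrix.mul_one, Matrix.mul_assoc]
  rw [hquad, conjTranspose_mul, conjTranspose_conjTranspose, Matrix.mul_assoc Pmᴴ S,
    hCcov.isHermitian.eq] at hmin
  linarith
end

section
/- Let Σ ∈ ℂ^{N×N} be Hermitian positive semidefinite, let σ > 0, let S₁ ∈ ℂ^{m₁×N} and S₂ ∈ ℂ^{m₂×N}, and let S ∈ ℂ^{(m₁+m₂)×N} be the vertical stack of S₁ on top of S₂. Define the posterior covariances Σ₁ = Σ − Σ S₁ᴴ (S₁ Σ S₁ᴴ + σ² I_{m₁})⁻¹ S₁ Σ and Σ_full = Σ − Σ Sᴴ (S Σ Sᴴ + σ² I_{m₁+m₂})⁻¹ S Σ. Then Σ_full ⪯ Σ₁ in the Loewner order, i.e., Σ₁ − Σ_full is Hermitian positive semidefinite. In words: taking additional measurements can only decrease the posterior covariance. 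-/
open Matrix
open scoped ComplexOrder

/-- The compression of `M⁻¹` dominates the inverse of the compression of `M`. -/
theorem Matrix.PosDef.posSemidef_inv_sub_conjTranspose_mul_inv_mul
    {m n : Type*} [Fintype m] [Fintype n] [DecidableEq m] [DecidableEq n]
    {M : Matrix n n ℂ} (hM : M.PosDef) (P : Matrix m n ℂ) (hP : IsUnit (P * M * Pᴴ)) :
    (M⁻¹ - Pᴴ * (P * M * Pᴴ)⁻¹ * P).PosSemidef := by
  set A := P * M * Pᴴ with hA
  set W := M⁻¹ - Pᴴ * A⁻¹ * P with hW
  have hAh : A.IsHermitian := isHermitian_mul_mul_conjTranspose P hM.isHermitian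
  have hWh : Wᴴ = W := by
    simp only [hW, conjTranspose_sub, conjTranspose_mul, conjTranspose_conjTranspose,
      hM.isHermitian.inv.eq, hAh.inv.eq, Matrix.mul_assoc]
  have hMdet : IsUnit M.det := (isUnit_iff_isUnit_det M).1 hM.isUnit
  have hAdet : IsUnit A.det := (isUnit_iff_isUnit_det A).1 hP
  have hPMW : P * (M * W) = 0 := by
    have h : P * (M * W) = P * (M * M⁻¹) - A * A⁻¹ * P := by
      simp only [hW, hA, Matrix.mul_sub, Matrix.mul_assoc]
    rw [h, mul_nonsing_inv _ hMdet, mul_nonsing_inv _ hAdet, Matrix.mul_one, Matrix.one_mul,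
      sub_self]
  have hWMW : Wᴴ * M * W = W := by
    have h : W * M * W = M⁻¹ * M * W - Pᴴ * A⁻¹ * (P * (M * W)) := by
      conv_lhs => rw [hW, Matrix.sub_mul, Matrix.sub_mul, ← hW]
      simp only [Matrix.mul_assoc]
    rw [hWh, h, hPMW, nonsing_inv_mul _ hMdet, Matrix.one_mul, Matrix.mul_zero, sub_zero]
  rw [← hWMW]
  exact hM.posSemidef.conjTranspose_mul_mul_same W

/-- The covariance of a noisy measurement is positive definite. -/
theorem Matrix.PosSemidef.posDef_mul_mul_conjTranspose_add_sq_smul_one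
    {m n : Type*} [Fintype m] [Fintype n] [DecidableEq m]
    {K : Matrix n n ℂ} (hK : K.PosSemidef) (S : Matrix m n ℂ) {σ : ℝ} (hσ : 0 < σ) :
    (S * K * Sᴴ + ((σ : ℂ) ^ 2) • (1 : Matrix m m ℂ)).PosDef := by
  have hσ' : (0 : ℂ) < (σ : ℂ) ^ 2 := by exact_mod_cast pow_pos hσ 2
  exact (PosDef.one.smul hσ').posSemidef_add (hK.mul_mul_conjTranspose_same S)

/-- **Monotonicity of the posterior covariance in the measurements (Loewner
order).** If `S` is the vertical stack of `S₁` on top of `S₂`, then the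
posterior covariance after observing through `S` is dominated by the posterior
covariance after observing only through `S₁`:
`Σ_full ⪯ C₁`, i.e. `C₁ − Σ_full` is Hermitian PSD. -/
theorem posterior_covariance_monotone
    {N m₁ m₂ : ℕ}
    (K : Matrix (Fin N) (Fin N) ℂ) (hK : K.PosSemidef)
    (σ : ℝ) (hσ : 0 < σ)
    (S₁ : Matrix (Fin m₁) (Fin N) ℂ) (S₂ : Matrix (Fin m₂) (Fin N) ℂ)
    (S : Matrix (Fin m₁ ⊕ Fin m₂) (Fin N) ℂ) (hS : S = Matrix.fromRows S₁ S₂)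
    (C₁ Cfull : Matrix (Fin N) (Fin N) ℂ)
    (hC₁ : C₁ = K - K * S₁ᴴ *
      (S₁ * K * S₁ᴴ + ((σ : ℂ) ^ 2) • (1 : Matrix (Fin m₁) (Fin m₁) ℂ))⁻¹ * S₁ * K)
    (hCfull : Cfull = K - K * Sᴴ *
      (S * K * Sᴴ + ((σ : ℂ) ^ 2) • (1 : Matrix (Fin m₁ ⊕ Fin m₂) (Fin m₁ ⊕ Fin m₂) ℂ))⁻¹
        * S * K) :
    (C₁ - Cfull).PosSemidef := by
  have hM := hK.posDef_mul_mul_conjTranspose_add_sq_smul_one S hσ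
  have hM₁ := hK.posDef_mul_mul_conjTranspose_add_sq_smul_one S₁ hσ
  set M := S * K * Sᴴ +
    ((σ : ℂ) ^ 2) • (1 : Matrix (Fin m₁ ⊕ Fin m₂) (Fin m₁ ⊕ Fin m₂) ℂ) with hMdef
  let P : Matrix (Fin m₁) (Fin m₁ ⊕ Fin m₂) ℂ := fromCols 1 0
  have hPS : P * S = S₁ := by simp [P, hS, fromCols_mul_fromRows]
  have hPP : P * Pᴴ = 1 := by
    simp [P, conjTranspose_fromCols_eq_fromRows_conjTranspose, fromCols_mul_fromRows]
  have hPMP : S₁ * K * S₁ᴴ + ((σ : ℂ) ^ 2) • (1 : Matrix (Fin m₁) (Fin m₁) ℂ) = P * M * Pᴴ := by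
    rw [hMdef, Matrix.mul_add, Matrix.add_mul, Matrix.mul_smul, Matrix.smul_mul, Matrix.mul_one,
      hPP, ← hPS, conjTranspose_mul]
    simp only [Matrix.mul_assoc]
  rw [hPMP] at hM₁ hC₁
  have key := (hM.posSemidef_inv_sub_conjTranspose_mul_inv_mul P hM₁.isUnit)
    |>.mul_mul_conjTranspose_same (K * Sᴴ)
  convert key using 1
  rw [hC₁, hCfull, ← hPS, sub_sub_sub_cancel_left]
  simp only [conjTranspose_mul, conjTranspose_conjTranspose, hK.isHermitian.eq, Matrix.mul_sub,
    Matrix.sub_mul, Matrix.mul_assoc]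
end

section
/- Let Σ ∈ ℂ^{N×N} be Hermitian positive semidefinite, let σ > 0, let m ≤ N be a positive integer, and let S ∈ ℂ^{m×N} satisfy S Sᴴ = I_m (orthonormal rows). Then Re Tr(Σ Sᴴ (S Σ Sᴴ + σ² I_m)⁻¹ S Σ) ≤ Re Tr(Σ (Σ + σ² I_N)⁻¹ Σ). Equivalently, the trace of the posterior covariance under partial observation with S is at least the trace of the posterior covariance under full observation: Re Tr(Σ − Σ Sᴴ (S Σ Sᴴ + σ² I_m)⁻¹ S Σ) ≥ Re Tr(Σ − Σ (Σ + σ² I_N)⁻¹ Σ). -/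
open Matrix
open scoped ComplexOrder

/-- The inverse of a positive definite matrix dominates every compressed inverse. -/
theorem Matrix.PosDef.posSemidef_inv_sub_compression {m n : Type*} [Fintype m] [Fintype n]
    [DecidableEq m] [DecidableEq n] {A : Matrix n n ℂ} (hA : A.PosDef) (S : Matrix m n ℂ)
    (hB : IsUnit (S * A * Sᴴ)) :
    (A⁻¹ - Sᴴ * (S * A * Sᴴ)⁻¹ * S).PosSemidef := by
  set B := S * A * Sᴴ with hBdef
  have hBh : B.IsHermitian := isHermitian_mul_mul_conjTranspose S hA.isHermitian
  have hQ : (Sᴴ * B⁻¹ * S).IsHermitian := isHermitian_conjTranspose_mul_mul S hBh.inv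
  have hdet : IsUnit A.det := (isUnit_iff_isUnit_det A).mp hA.isUnit
  have hdetB : IsUnit B.det := (isUnit_iff_isUnit_det B).mp hB
  have hQAQ : Sᴴ * B⁻¹ * S * A * (Sᴴ * B⁻¹ * S) = Sᴴ * B⁻¹ * S := by
    calc _ = Sᴴ * (B⁻¹ * (S * A * Sᴴ) * B⁻¹) * S := by simp only [Matrix.mul_assoc]
      _ = _ := by rw [← hBdef, nonsing_inv_mul B hdetB, Matrix.one_mul]
  have hP : (A⁻¹ - Sᴴ * B⁻¹ * S)ᴴ * A * (A⁻¹ - Sᴴ * B⁻¹ * S) = A⁻¹ - Sᴴ * B⁻¹ * S := by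
    rw [(hA.isHermitian.inv.sub hQ).eq, Matrix.sub_mul, nonsing_inv_mul A hdet, Matrix.sub_mul,
      Matrix.one_mul, Matrix.mul_sub, hQAQ, mul_nonsing_inv_cancel_right A _ hdet, sub_self, sub_zero]
  rw [← hP]
  exact hA.posSemidef.conjTranspose_mul_mul_same _

/-- **Full observation minimizes the posterior trace.** For Hermitian PSD `Σ`,
`σ > 0`, and `S ∈ ℂ^{m×N}` with orthonormal rows (`S Sᴴ = I_m`, `m ≤ N`),
`Re Tr(Σ Sᴴ (S Σ Sᴴ + σ² I_m)⁻¹ S Σ) ≤ Re Tr(Σ (Σ + σ² I_N)⁻¹ Σ)`; equivalently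
the trace of the partial-observation posterior covariance is at least that of
the full-observation posterior covariance. -/
theorem partial_observation_posterior_trace_ge
    {N m : ℕ} (hm : 0 < m) (hmN : m ≤ N)
    (K : Matrix (Fin N) (Fin N) ℂ) (hK : K.PosSemidef)
    (σ : ℝ) (hσ : 0 < σ)
    (S : Matrix (Fin m) (Fin N) ℂ) (hS : S * Sᴴ = 1) :
    (K * Sᴴ * (S * K * Sᴴ + ((σ : ℂ) ^ 2) • (1 : Matrix (Fin m) (Fin m) ℂ))⁻¹
        * S * K).trace.re ≤
      (K * (K + ((σ : ℂ) ^ 2) • (1 : Matrix (Fin N) (Fin N) ℂ))⁻¹ * K).trace.re ∧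
    (K - K * (K + ((σ : ℂ) ^ 2) • (1 : Matrix (Fin N) (Fin N) ℂ))⁻¹ * K).trace.re ≤
      (K - K * Sᴴ * (S * K * Sᴴ + ((σ : ℂ) ^ 2) • (1 : Matrix (Fin m) (Fin m) ℂ))⁻¹
        * S * K).trace.re := by
  have hσ2 : (0 : ℂ) < (σ : ℂ) ^ 2 := by exact_mod_cast pow_pos hσ 2
  set A := K + ((σ : ℂ) ^ 2) • (1 : Matrix (Fin N) (Fin N) ℂ) with hA
  have hApd : A.PosDef := Matrix.PosDef.posSemidef_add hK (Matrix.PosDef.one.smul hσ2)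
  have hSAS : S * K * Sᴴ + ((σ : ℂ) ^ 2) • (1 : Matrix (Fin m) (Fin m) ℂ) = S * A * Sᴴ := by
    simp [hA, Matrix.mul_add, Matrix.add_mul, hS]
  have hBpd : (S * A * Sᴴ).PosDef := hSAS ▸
    Matrix.PosDef.posSemidef_add (hK.mul_mul_conjTranspose_same S) (Matrix.PosDef.one.smul hσ2)
  have hpsd := (hApd.posSemidef_inv_sub_compression S hBpd.isUnit).mul_mul_conjTranspose_same K
  have hre := (Complex.le_def.mp hpsd.trace_nonneg).1
  rw [hK.isHermitian.eq, Matrix.mul_sub, Matrix.sub_mul, trace_sub, Complex.sub_re,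
    Complex.zero_re, sub_nonneg] at hre
  rw [hSAS]
  simp only [← Matrix.mul_assoc, trace_sub, Complex.sub_re] at hre ⊢
  exact ⟨hre, sub_le_sub_left hre _⟩
end

section
/- Let Σ, Σcov ∈ ℂ^{N×N} be Hermitian positive semidefinite and let S ∈ ℂ^{m×N}. Then the following are equivalent: (i) for every σ > 0, the regression matrices coincide, i.e., (S Σ Sᴴ + σ² I_m)⁻¹ S Σ = (S Σcov Sᴴ + σ² I_m)⁻¹ S Σcov; (ii) S Σ = S Σcov. In particular, a mismatched kernel Σ yields the same Bayesian reconstructor as the true covariance Σcov at every noise level if and only if S (Σ − Σcov) = 0. -/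
open Matrix
open scoped ComplexOrder

/-- A positive semidefinite `S K Sᴴ` plus a positive multiple of the identity is invertible. -/
theorem isUnit_det_conj_add_smul_one {n m : Type*} [Fintype n] [Fintype m] [DecidableEq m]
    {K : Matrix n n ℂ} (hK : K.PosSemidef) (S : Matrix m n ℂ) {c : ℂ} (hc : 0 < c) :
    IsUnit (S * K * Sᴴ + c • (1 : Matrix m m ℂ)).det :=
  (Matrix.isUnit_iff_isUnit_det _).1
    (Matrix.PosDef.posSemidef_add (hK.mul_mul_conjTranspose_same S)
      (Matrix.PosDef.one.smul hc)).isUnit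

/-- Equality of two regularized regression matrices at a single nonzero regularization parameter
forces equality of the cross-covariances. -/
theorem mul_eq_mul_of_regression_eq {n m R : Type*} [Fintype n] [Fintype m] [DecidableEq m]
    [Field R] [StarRing R] {K C : Matrix n n R} {S : Matrix m n R} {c : R} (hc : c ≠ 0)
    (hX : IsUnit (S * K * Sᴴ + c • (1 : Matrix m m R)).det)
    (hY : IsUnit (S * C * Sᴴ + c • (1 : Matrix m m R)).det)
    (h : (S * K * Sᴴ + c • (1 : Matrix m m R))⁻¹ * (S * K) =
      (S * C * Sᴴ + c • (1 : Matrix m m R))⁻¹ * (S * C)) :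
    S * K = S * C := by
  have key (D : Matrix n n R) (hD : IsUnit (S * D * Sᴴ + c • (1 : Matrix m m R)).det) :
      (S * D * Sᴴ + c • (1 : Matrix m m R))⁻¹ * (S * D) * Sᴴ =
        1 - c • (S * D * Sᴴ + c • (1 : Matrix m m R))⁻¹ := by
    rw [eq_sub_iff_add_eq]
    simpa [Matrix.mul_add, Matrix.mul_assoc] using Matrix.nonsing_inv_mul _ hD
  have hinv : (S * K * Sᴴ + c • (1 : Matrix m m R))⁻¹ =
      (S * C * Sᴴ + c • (1 : Matrix m m R))⁻¹ := by
    have h' := congrArg (· * Sᴴ) h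
    simp only [key K hX, key C hY, sub_right_inj] at h'
    exact smul_right_injective _ hc h'
  rw [← hinv] at h
  have h' := congrArg ((S * K * Sᴴ + c • (1 : Matrix m m R)) * ·) h
  simpa only [Matrix.mul_nonsing_inv_cancel_left _ _ hX] using h'

/-- **When does a mismatched kernel give the same reconstructor?** For Hermitian
PSD `Σ`, `Σcov` and any `S`, the kernel-based regression matrices coincide at
every noise level `σ > 0` iff `S Σ = S Σcov`, iff `S (Σ − Σcov) = 0`. -/
theorem mismatched_kernel_same_reconstructor_iff
    {N m : ℕ}
    (K Ccov : Matrix (Fin N) (Fin N) ℂ)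
    (hK : K.PosSemidef) (hCcov : Ccov.PosSemidef)
    (S : Matrix (Fin m) (Fin N) ℂ) :
    ((∀ σ : ℝ, 0 < σ →
        (S * K * Sᴴ + ((σ : ℂ) ^ 2) • (1 : Matrix (Fin m) (Fin m) ℂ))⁻¹ * (S * K) =
          (S * Ccov * Sᴴ + ((σ : ℂ) ^ 2) • (1 : Matrix (Fin m) (Fin m) ℂ))⁻¹ * (S * Ccov)) ↔
      S * K = S * Ccov) ∧
    ((∀ σ : ℝ, 0 < σ →
        (S * K * Sᴴ + ((σ : ℂ) ^ 2) • (1 : Matrix (Fin m) (Fin m) ℂ))⁻¹ * (S * K) =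
          (S * Ccov * Sᴴ + ((σ : ℂ) ^ 2) • (1 : Matrix (Fin m) (Fin m) ℂ))⁻¹ * (S * Ccov)) ↔
      S * (K - Ccov) = 0) := by
  rw [Matrix.mul_sub, sub_eq_zero, and_self]
  refine ⟨fun h => ?_, fun h σ _ => by rw [h]⟩
  have hc : (0 : ℂ) < ((1 : ℝ) : ℂ) ^ 2 := by simp
  exact mul_eq_mul_of_regression_eq hc.ne' (isUnit_det_conj_add_smul_one hK S hc)
    (isUnit_det_conj_add_smul_one hCcov S hc) (h 1 one_pos)
end
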